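/- arXiv:1605.02930 — 4 statements merged into one kernel-verified Lean document; each statement's English description precedes it below -/
import Mathlib

section
/- Let p : ℝ → ℝ be a C^∞ function with p(θ + 2π) = p(θ) for all θ and p(θ) + p''(θ) > 0 for all θ. Set L = ∫₀^{2π} p(θ) dθ, ρ(θ) = p(θ) + p''(θ), κ(θ) = 1/ρ(θ), and Q(θ) = p(θ) + p(θ+π) − L/π. Then for every θ with Q(θ) + Q''(θ) ≠ 0 one has 1/|Q(θ) + Q''(θ)| = κ(θ)·κ(θ+π) / |κ(θ) + κ(θ+π) − (L/π)·κ(θ)·κ(θ+π)|; that is, the curvature of the Constant Width Measure Set at the non-singular point corresponding to the parallel pair (γ(θ), γ(θ+π)) equals κ(θ)κ(θ+π)/|κ(θ) + κ(θ+π) − w̄·κ(θ)κ(θ+π)|, where w̄ = L/π is the average width. -/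
open Real

/-- The second derivative of `x ↦ f x + f (x + a) - c`. -/
theorem deriv_deriv_add_shift_sub_const {f : ℝ → ℝ} (hf : ContDiff ℝ 2 f) (a c : ℝ) :
    deriv (deriv fun x => f x + f (x + a) - c) =
      fun x => deriv (deriv f) x + deriv (deriv f) (x + a) := by
  have hf₀ : Differentiable ℝ f := hf.differentiable (by norm_num)
  have hf₁ : Differentiable ℝ (deriv f) :=
    (hf.iterate_deriv' 1 1).differentiable (by norm_num)
  have h : (deriv fun x => f x + f (x + a) - c) = fun x => deriv f x + deriv f (x + a) := by
    funext x
    exact (((hf₀ x).hasDerivAt.add ((hf₀ (x + a)).hasDerivAt.comp_add_const x a)).sub_const c).deriv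
  rw [h]
  funext x
  exact ((hf₁ x).hasDerivAt.add ((hf₁ (x + a)).hasDerivAt.comp_add_const x a)).deriv

theorem stmt_1 (p Q ρ κ : ℝ → ℝ) (hp : ContDiff ℝ (⊤ : ℕ∞) p)
    (hper : ∀ θ : ℝ, p (θ + 2 * π) = p θ)
    (hpos : ∀ θ : ℝ, p θ + deriv (deriv p) θ > 0)
    (L : ℝ) (hL : L = ∫ θ in (0:ℝ)..(2 * π), p θ)
    (hρ : ∀ θ : ℝ, ρ θ = p θ + deriv (deriv p) θ)
    (hκ : ∀ θ : ℝ, κ θ = 1 / ρ θ)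
    (hQ : ∀ θ : ℝ, Q θ = p θ + p (θ + π) - L / π) :
    ∀ θ : ℝ, Q θ + deriv (deriv Q) θ ≠ 0 →
      1 / |Q θ + deriv (deriv Q) θ| =
        κ θ * κ (θ + π) / |κ θ + κ (θ + π) - (L / π) * (κ θ * κ (θ + π))| := by
  intro θ _
  have hsum : Q θ + deriv (deriv Q) θ = ρ θ + ρ (θ + π) - L / π := by
    rw [funext hQ, deriv_deriv_add_shift_sub_const (contDiff_infty.1 hp 2), hρ, hρ]
    ring
  have hρpos : ∀ x, 0 < ρ x := fun x => hρ x ▸ hpos x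
  have ha := hρpos θ
  have hb := hρpos (θ + π)
  have hcurv : κ θ + κ (θ + π) - L / π * (κ θ * κ (θ + π)) =
      (ρ θ + ρ (θ + π) - L / π) * (κ θ * κ (θ + π)) := by
    rw [hκ, hκ]
    field_simp
    ring
  have hκpos : 0 < κ θ * κ (θ + π) := by
    rw [hκ, hκ]
    positivity
  rw [hsum, hcurv, abs_mul, abs_of_pos hκpos, div_mul_cancel_right₀ hκpos.ne', one_div]
end

section
/- (Improved isoperimetric inequality 2, with equality case.) Let p : ℝ → ℝ be a C^∞ function with p(θ + 2π) = p(θ) for all θ and p(θ) + p''(θ) > 0 for all θ. Set L = ∫₀^{2π} p(θ) dθ, A = (1/2)∫₀^{2π}(p(θ)² − p'(θ)²) dθ and Q(θ) = p(θ) + p(θ+π) − L/π. Then L² ≥ 4πA − (π/2) ∫₀^{2π}(Q(θ)² − Q'(θ)²) dθ (i.e. L_M² ≥ 4πA_M + π|Ã_{CWMS(M)}|), and equality holds if and only if there exists c = (c₁, c₂) ∈ ℝ² such that p(θ) − p(θ+π) = 2(c₁ cos θ + c₂ sin θ) for all θ, i.e. if and only if the oval M is centrally symmetric. -/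
open Real

/-- **Wirtinger's inequality**: a `C¹` function of mean zero with `f (2π) = f 0` has
`∫ (f ^ 2 - (deriv f) ^ 2) ≤ 0` over a period. -/
theorem integral_sq_sub_deriv_sq_nonpos {f : ℝ → ℝ} (hf : ContDiff ℝ 1 f)
    (hend : f (2 * π) = f 0) (hmean : ∫ θ in (0:ℝ)..(2 * π), f θ = 0) :
    ∫ θ in (0:ℝ)..(2 * π), (f θ ^ 2 - deriv f θ ^ 2) ≤ 0 := by
  have hab : (0:ℝ) < 2 * π := by positivity
  have hc : Continuous f := hf.continuous
  have hc' : Continuous (deriv f) := hf.continuous_deriv le_rfl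
  have parseval {g : ℝ → ℝ} (hg : Continuous g) :
      HasSum (fun i => ‖fourierCoeffOn hab (fun x => (g x : ℂ)) i‖ ^ 2)
        ((2 * π - 0)⁻¹ • ∫ x in (0:ℝ)..(2 * π), ‖(g x : ℂ)‖ ^ 2) := by
    refine hasSum_sq_fourierCoeffOn hab ?_
    have hg' : Continuous fun x => (g x : ℂ) := Complex.continuous_ofReal.comp hg
    have hbdd : BddAbove ((fun x => ‖(g x : ℂ)‖) '' Set.Icc 0 (2 * π)) :=
      isCompact_Icc.bddAbove_image hg'.norm.continuousOn
    obtain ⟨C, hC⟩ := hbdd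
    refine MeasureTheory.MemLp.of_bound hg'.aestronglyMeasurable C ?_
    filter_upwards [MeasureTheory.ae_restrict_mem measurableSet_Ioc] with x hx
    exact hC ⟨x, Set.Ioc_subset_Icc_self hx, rfl⟩
  have hle : ((2 * π - 0)⁻¹ • ∫ x in (0:ℝ)..(2 * π), ‖(f x : ℂ)‖ ^ 2) ≤
      (2 * π - 0)⁻¹ • ∫ x in (0:ℝ)..(2 * π), ‖((deriv f x : ℝ) : ℂ)‖ ^ 2 := by
    refine hasSum_le (fun n => ?_) (parseval hc) (parseval hc')
    rcases eq_or_ne n 0 with rfl | hn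
    · have : fourierCoeffOn hab (fun x => (f x : ℂ)) 0 = 0 := by
        rw [fourierCoeffOn_eq_integral]
        simp [intervalIntegral.integral_ofReal, hmean]
      rw [this]
      simp
    · have hcoeff := fourierCoeffOn_of_hasDerivAt hab hn
        (f := fun x => (f x : ℂ)) (f' := fun x => ((deriv f x : ℝ) : ℂ))
        (fun x _ => ((hf.differentiable one_ne_zero) x).hasDerivAt.ofReal_comp)
        ((Complex.continuous_ofReal.comp hc').intervalIntegrable _ _)
      have hn1 : (1:ℝ) ≤ |(n:ℝ)| := by exact_mod_cast Int.one_le_abs hn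
      have hnorm : ‖fourierCoeffOn hab (fun x => (f x : ℂ)) n‖ * |(n:ℝ)| =
          ‖fourierCoeffOn hab (fun x => ((deriv f x : ℝ) : ℂ)) n‖ := by
        rw [hcoeff, hend]
        have hn0 : |(n:ℝ)| ≠ 0 := by positivity
        simp [abs_of_pos pi_pos]
        field_simp
      rw [← hnorm]
      gcongr
      exact le_mul_of_one_le_right (norm_nonneg _) hn1
  simp only [Complex.norm_real, norm_eq_abs, sq_abs, smul_eq_mul, sub_zero] at hle
  rw [intervalIntegral.integral_sub (Continuous.intervalIntegrable (by fun_prop) _ _)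
    (Continuous.intervalIntegrable (by fun_prop) _ _)]
  have := le_of_mul_le_mul_left hle (by positivity)
  linarith

/-- Solutions of the harmonic oscillator equation are combinations of cosine and sine. -/
theorem eq_cos_add_sin_of_deriv_deriv_eq_neg {f : ℝ → ℝ} (hf : ContDiff ℝ 2 f)
    (hode : ∀ θ, deriv (deriv f) θ = - f θ) (θ : ℝ) :
    f θ = f 0 * cos θ + deriv f 0 * sin θ := by
  have hd (x : ℝ) : HasDerivAt f (deriv f x) x :=
    (hf.differentiable two_ne_zero x).hasDerivAt
  have hd' (x : ℝ) : HasDerivAt (deriv f) (- f x) x := by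
    rw [← hode x]
    exact (((contDiff_succ_iff_deriv (n := 1)).1 hf).2.2.differentiable one_ne_zero x).hasDerivAt
  have hu (x : ℝ) : HasDerivAt (fun y => f y * cos y - deriv f y * sin y) 0 x :=
    (((hd x).mul (hasDerivAt_cos x)).sub ((hd' x).mul (hasDerivAt_sin x))).congr_deriv
      (by ring)
  have hv (x : ℝ) : HasDerivAt (fun y => f y * sin y + deriv f y * cos y) 0 x :=
    (((hd x).mul (hasDerivAt_sin x)).add ((hd' x).mul (hasDerivAt_cos x))).congr_deriv
      (by ring)
  have hu' := is_const_of_deriv_eq_zero (fun x => (hu x).differentiableAt)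
    (fun x => (hu x).deriv) θ 0
  have hv' := is_const_of_deriv_eq_zero (fun x => (hv x).differentiableAt)
    (fun x => (hv x).deriv) θ 0
  simp only [cos_zero, sin_zero, mul_one, mul_zero, sub_zero, zero_add] at hu' hv'
  rw [← hu', ← hv']
  linear_combination (-f θ) * sin_sq_add_cos_sq θ

/-- Integration by parts over a period for the bilinear form of Wirtinger's inequality. -/
theorem integral_mul_add_deriv_deriv {f g : ℝ → ℝ} (hf : ContDiff ℝ 2 f) (hg : ContDiff ℝ 1 g)
    (hfper : Function.Periodic f (2 * π)) (hgper : Function.Periodic g (2 * π)) :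
    ∫ θ in (0:ℝ)..(2 * π), (g θ * f θ - deriv g θ * deriv f θ) =
      ∫ θ in (0:ℝ)..(2 * π), g θ * (f θ + deriv (deriv f) θ) := by
  have hf' : ContDiff ℝ 1 (deriv f) := ((contDiff_succ_iff_deriv (n := 1)).1 hf).2.2
  have hf'per : deriv f (2 * π) = deriv f 0 := by
    rw [← zero_add (2 * π), ← deriv_comp_add_const f (2 * π) 0]
    congr 1
    exact funext hfper
  have hc := hf.continuous
  have hc' := hf'.continuous
  have hc'' := hf'.continuous_deriv le_rfl
  have hgc := hg.continuous
  have hgc' := hg.continuous_deriv le_rfl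
  have hparts := intervalIntegral.integral_mul_deriv_eq_deriv_mul (a := 0) (b := 2 * π)
    (fun x _ => (hg.differentiable one_ne_zero x).hasDerivAt)
    (fun x _ => (hf'.differentiable one_ne_zero x).hasDerivAt)
    (hgc'.intervalIntegrable _ _) (hc''.intervalIntegrable _ _)
  have hgend : g (2 * π) = g 0 := by simpa using hgper 0
  rw [hf'per, hgend, sub_self, zero_sub] at hparts
  simp only [mul_add]
  rw [intervalIntegral.integral_sub (Continuous.intervalIntegrable (by fun_prop) _ _)
      (Continuous.intervalIntegrable (by fun_prop) _ _),
    intervalIntegral.integral_add (Continuous.intervalIntegrable (by fun_prop) _ _)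
      (Continuous.intervalIntegrable (by fun_prop) _ _), hparts]
  ring

/-- The equality case of Wirtinger's inequality. -/
theorem integral_sq_sub_deriv_sq_eq_zero_iff {f : ℝ → ℝ} (hf : ContDiff ℝ (⊤ : ℕ∞) f)
    (hper : Function.Periodic f (2 * π)) (hmean : ∫ θ in (0:ℝ)..(2 * π), f θ = 0) :
    ∫ θ in (0:ℝ)..(2 * π), (f θ ^ 2 - deriv f θ ^ 2) = 0 ↔
      ∀ θ, deriv (deriv f) θ = - f θ := by
  have hf' : ContDiff ℝ (⊤ : ℕ∞) (deriv f) := (contDiff_infty_iff_deriv.1 hf).2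
  have hf'' : ContDiff ℝ (⊤ : ℕ∞) (deriv (deriv f)) := (contDiff_infty_iff_deriv.1 hf').2
  have hf2 : ContDiff ℝ 2 f := contDiff_infty.1 hf 2
  have hper' : Function.Periodic (deriv f) (2 * π) := fun x => by
    rw [← deriv_comp_add_const f (2 * π) x]
    congr 1
    exact funext hper
  have hper'' : Function.Periodic (deriv (deriv f)) (2 * π) := fun x => by
    rw [← deriv_comp_add_const (deriv f) (2 * π) x]
    congr 1
    exact funext hper'
  constructor
  · intro hzero
    obtain ⟨g, hg⟩ : ∃ g : ℝ → ℝ, g = fun θ => f θ + deriv (deriv f) θ := ⟨_, rfl⟩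
    have hgs : ContDiff ℝ (⊤ : ℕ∞) g := hg ▸ hf.add hf''
    have hg1 : ContDiff ℝ 1 g := hgs.of_le (by simp)
    have hgper : Function.Periodic g (2 * π) := fun x => by simp [hg, hper x, hper'' x]
    have hgmean : ∫ θ in (0:ℝ)..(2 * π), g θ = 0 := by
      rw [hg, intervalIntegral.integral_add (hf.continuous.intervalIntegrable _ _)
        (hf''.continuous.intervalIntegrable _ _), hmean,
        intervalIntegral.integral_deriv_eq_sub
          (fun x _ => hf'.differentiable (by simp) x) (hf''.continuous.intervalIntegrable _ _)]
      have := hper' 0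
      simp only [zero_add] at this
      simp [this]
    have hcross : ∫ θ in (0:ℝ)..(2 * π), (g θ * f θ - deriv g θ * deriv f θ) =
        ∫ θ in (0:ℝ)..(2 * π), g θ ^ 2 := by
      rw [integral_mul_add_deriv_deriv hf2 hg1 hper hgper]
      simp only [hg, sq]
    have hc := hf.continuous
    have hc' := hf'.continuous
    have hgc := hgs.continuous
    have hgc' := hg1.continuous_deriv le_rfl
    have hquad (t : ℝ) : 2 * t * (∫ θ in (0:ℝ)..(2 * π), g θ ^ 2) +
        t ^ 2 * (∫ θ in (0:ℝ)..(2 * π), (g θ ^ 2 - deriv g θ ^ 2)) ≤ 0 := by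
      have hw := integral_sq_sub_deriv_sq_nonpos (f := fun θ => f θ + t * g θ)
        ((hf2.of_le one_le_two).add (contDiff_const.mul hg1))
        (by have h1 := hper 0; have h2 := hgper 0; simp only [zero_add] at h1 h2; rw [h1, h2])
        (by
          rw [intervalIntegral.integral_add (hc.intervalIntegrable _ _)
            ((hgc.const_mul t).intervalIntegrable _ _), hmean,
            intervalIntegral.integral_const_mul, hgmean]
          simp)
      have hd (θ : ℝ) : deriv (fun θ => f θ + t * g θ) θ = deriv f θ + t * deriv g θ :=
        ((hf.differentiable (by simp) θ).hasDerivAt.add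
          ((hg1.differentiable one_ne_zero θ).hasDerivAt.const_mul t)).deriv
      have hexp : ∫ θ in (0:ℝ)..(2 * π),
          ((f θ + t * g θ) ^ 2 - (deriv (fun θ => f θ + t * g θ) θ) ^ 2) =
          ∫ θ in (0:ℝ)..(2 * π), ((f θ ^ 2 - deriv f θ ^ 2) +
            2 * t * (g θ * f θ - deriv g θ * deriv f θ) +
            t ^ 2 * (g θ ^ 2 - deriv g θ ^ 2)) := by
        congr 1
        funext θ
        rw [hd]
        ring
      rw [hexp, intervalIntegral.integral_add
        (Continuous.intervalIntegrable (by fun_prop) _ _)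
        (Continuous.intervalIntegrable (by fun_prop) _ _),
        intervalIntegral.integral_add
        (Continuous.intervalIntegrable (by fun_prop) _ _)
        (Continuous.intervalIntegrable (by fun_prop) _ _),
        intervalIntegral.integral_const_mul, intervalIntegral.integral_const_mul,
        hzero, hcross, zero_add] at hw
      exact hw
    have hg0 : ∫ θ in (0:ℝ)..(2 * π), g θ ^ 2 = 0 := by
      generalize (∫ θ in (0:ℝ)..(2 * π), (g θ ^ 2 - deriv g θ ^ 2)) = b at hquad
      have hnonneg : 0 ≤ ∫ θ in (0:ℝ)..(2 * π), g θ ^ 2 :=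
        intervalIntegral.integral_nonneg (by positivity) fun _ _ => sq_nonneg _
      generalize (∫ θ in (0:ℝ)..(2 * π), g θ ^ 2) = a at hquad hnonneg
      by_contra hne
      have ha : 0 < a := lt_of_le_of_ne hnonneg (Ne.symm hne)
      have hden : 0 < |b| + 1 := by positivity
      have h := hquad (a / (|b| + 1))
      have hbt : a / (|b| + 1) * (|b| + 1) = a := div_mul_cancel₀ _ hden.ne'
      have ht : 0 < a / (|b| + 1) := by positivity
      generalize a / (|b| + 1) = t at h hbt ht
      nlinarith [neg_abs_le b, mul_pos ht ha, mul_pos ht ht,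
        mul_nonneg (mul_pos ht ht).le (by linarith [neg_abs_le b] : 0 ≤ b + |b|)]
    have hgzero : ∀ θ ∈ Set.Icc 0 (2 * π), g θ = 0 := by
      by_contra! hne
      obtain ⟨c, hcmem, hcne⟩ := hne
      exact (intervalIntegral.integral_pos (by positivity) (hgc.pow 2).continuousOn
        (fun _ _ => sq_nonneg _) ⟨c, hcmem, sq_pos_of_ne_zero hcne⟩).ne' hg0
    intro θ
    obtain ⟨y, hy, hyθ⟩ := hgper.exists_mem_Ico₀ (by positivity) θ
    have := hgzero y (Set.Ico_subset_Icc_self hy)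
    rw [← hyθ, hg] at this
    simp only at this
    linarith
  · intro hode
    have h := integral_mul_add_deriv_deriv hf2 (hf2.of_le one_le_two) hper hper
    simp only [hode, ← sq, add_neg_cancel, mul_zero, intervalIntegral.integral_zero] at h
    exact h

theorem stmt_17 (p Q : ℝ → ℝ) (hp : ContDiff ℝ (⊤ : ℕ∞) p)
    (hper : ∀ θ : ℝ, p (θ + 2 * π) = p θ)
    (hpos : ∀ θ : ℝ, p θ + deriv (deriv p) θ > 0)
    (L A : ℝ) (hL : L = ∫ θ in (0:ℝ)..(2 * π), p θ)
    (hA : A = (1 / 2) * ∫ θ in (0:ℝ)..(2 * π), (p θ ^ 2 - deriv p θ ^ 2))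
    (hQ : ∀ θ : ℝ, Q θ = p θ + p (θ + π) - L / π) :
    L ^ 2 ≥ 4 * π * A - (π / 2) * (∫ θ in (0:ℝ)..(2 * π), (Q θ ^ 2 - deriv Q θ ^ 2)) ∧
    (L ^ 2 = 4 * π * A - (π / 2) * (∫ θ in (0:ℝ)..(2 * π), (Q θ ^ 2 - deriv Q θ ^ 2)) ↔
      ∃ c : ℝ × ℝ, ∀ θ : ℝ,
        p θ - p (θ + π) = 2 * (c.1 * Real.cos θ + c.2 * Real.sin θ)) := by
  have hc := hp.continuous
  have hp' : ContDiff ℝ (⊤ : ℕ∞) (deriv p) := (contDiff_infty_iff_deriv.1 hp).2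
  have hc' := hp'.continuous
  have hper' (θ : ℝ) : deriv p (θ + 2 * π) = deriv p θ := by
    rw [← deriv_comp_add_const p (2 * π) θ]
    congr 1
    exact funext hper
  have hshift {g : ℝ → ℝ} (hg : Function.Periodic g (2 * π)) :
      ∫ θ in (0:ℝ)..(2 * π), g (θ + π) = ∫ θ in (0:ℝ)..(2 * π), g θ := by
    rw [intervalIntegral.integral_comp_add_right, add_comm (2 * π) π, zero_add,
      hg.intervalIntegral_add_eq π 0, zero_add]
  have hdp (θ : ℝ) : HasDerivAt p (deriv p θ) θ := (hp.differentiable (by simp) θ).hasDerivAt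
  have hdq (θ : ℝ) : HasDerivAt (fun x => p (x + π)) (deriv p (θ + π)) θ :=
    (hdp (θ + π)).comp_add_const θ π
  obtain ⟨D, hD⟩ : ∃ D : ℝ → ℝ, D = fun θ => p θ - p (θ + π) := ⟨_, rfl⟩
  have hDapp (θ : ℝ) : p θ - p (θ + π) = D θ := by rw [hD]
  have hDs : ContDiff ℝ (⊤ : ℕ∞) D :=
    hD ▸ hp.sub (hp.comp (contDiff_id.add contDiff_const))
  have hDd (θ : ℝ) : deriv D θ = deriv p θ - deriv p (θ + π) := by
    rw [hD]
    exact ((hdp θ).sub (hdq θ)).deriv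
  have hDper : Function.Periodic D (2 * π) := fun θ => by
    simp only [hD]
    rw [hper, add_right_comm, hper]
  have hDmean : ∫ θ in (0:ℝ)..(2 * π), D θ = 0 := by
    rw [hD, intervalIntegral.integral_sub (hc.intervalIntegrable _ _)
      (Continuous.intervalIntegrable (by fun_prop) _ _), hshift hper, sub_self]
  have hQfun : Q = fun θ => p θ + p (θ + π) - L / π := funext hQ
  have hQd (θ : ℝ) : deriv Q θ = deriv p θ + deriv p (θ + π) := by
    rw [hQfun]
    exact (((hdp θ).add (hdq θ)).sub_const _).deriv
  have hshiftA := hshift (g := fun θ => p θ ^ 2 - deriv p θ ^ 2)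
    (fun θ => by simp only [hper, hper'])
  have hQsum : (∫ θ in (0:ℝ)..(2 * π), (D θ ^ 2 - deriv D θ ^ 2)) +
      (∫ θ in (0:ℝ)..(2 * π), (Q θ ^ 2 - deriv Q θ ^ 2)) = 8 * A - 2 * L ^ 2 / π := by
    have hexp (θ : ℝ) : (D θ ^ 2 - deriv D θ ^ 2) + (Q θ ^ 2 - deriv Q θ ^ 2) =
        2 * (p θ ^ 2 - deriv p θ ^ 2) + 2 * (p (θ + π) ^ 2 - deriv p (θ + π) ^ 2) -
          2 * (L / π) * (p θ + p (θ + π)) + (L / π) ^ 2 := by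
      rw [hDd, hQd, hQ, ← hDapp]
      ring
    rw [← intervalIntegral.integral_add
      (Continuous.intervalIntegrable (by simp only [hDd, ← hDapp]; fun_prop) _ _)
      (Continuous.intervalIntegrable (by simp only [hQd, hQ]; fun_prop) _ _)]
    simp only [hexp]
    rw [intervalIntegral.integral_add (Continuous.intervalIntegrable (by fun_prop) _ _)
        (Continuous.intervalIntegrable (by fun_prop) _ _),
      intervalIntegral.integral_sub (Continuous.intervalIntegrable (by fun_prop) _ _)
        (Continuous.intervalIntegrable (by fun_prop) _ _),
      intervalIntegral.integral_add (Continuous.intervalIntegrable (by fun_prop) _ _)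
        (Continuous.intervalIntegrable (by fun_prop) _ _),
      intervalIntegral.integral_const_mul, intervalIntegral.integral_const_mul,
      intervalIntegral.integral_const_mul,
      intervalIntegral.integral_add (Continuous.intervalIntegrable (by fun_prop) _ _)
        (Continuous.intervalIntegrable (by fun_prop) _ _),
      hshiftA, hshift hper, ← hL, intervalIntegral.integral_const, hA, smul_eq_mul]
    field_simp
    ring
  have hkey : 4 * π * A - (π / 2) * (∫ θ in (0:ℝ)..(2 * π), (Q θ ^ 2 - deriv Q θ ^ 2)) =
      L ^ 2 + (π / 2) * ∫ θ in (0:ℝ)..(2 * π), (D θ ^ 2 - deriv D θ ^ 2) := by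
    rw [eq_sub_of_add_eq' hQsum]
    field_simp
    ring
  have hDle := integral_sq_sub_deriv_sq_nonpos (hDs.of_le (by exact_mod_cast le_top))
    (by simpa using hDper 0) hDmean
  rw [hkey]
  refine ⟨by nlinarith [pi_pos], ?_⟩
  rw [left_eq_add, mul_eq_zero_iff_left (by positivity),
    integral_sq_sub_deriv_sq_eq_zero_iff hDs hDper hDmean]
  simp only [hDapp]
  constructor
  · intro hode
    refine ⟨(D 0 / 2, deriv D 0 / 2), fun θ => ?_⟩
    rw [eq_cos_add_sin_of_deriv_deriv_eq_neg (contDiff_infty.1 hDs 2) hode θ]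
    ring
  · rintro ⟨c, hDc⟩ θ
    have h1 : deriv D = fun θ => 2 * (c.1 * -sin θ + c.2 * cos θ) := by
      rw [funext hDc]
      exact funext fun x => ((((hasDerivAt_cos x).const_mul c.1).add
        ((hasDerivAt_sin x).const_mul c.2)).const_mul 2).deriv
    have h2 : HasDerivAt (deriv D) (2 * (c.1 * -cos θ + c.2 * -sin θ)) θ := by
      rw [h1]
      exact (((hasDerivAt_sin θ).neg.const_mul c.1).add
        ((hasDerivAt_cos θ).const_mul c.2)).const_mul 2
    rw [h2.deriv, hDc]
    ring
end

section
/- (Stability of the improved isoperimetric inequality in the Hausdorff metric.) Let p : ℝ → ℝ be a C^∞ function with p(θ + 2π) = p(θ) for all θ and p(θ) + p''(θ) > 0 for all θ. Set L = ∫₀^{2π} p(θ) dθ, A = (1/2)∫₀^{2π}(p(θ)² − p'(θ)²) dθ, Q(θ) = p(θ) + p(θ+π) − L/π, c₁ = (1/π)∫₀^{2π} p(θ) cos θ dθ, c₂ = (1/π)∫₀^{2π} p(θ) sin θ dθ, and p_S(θ) = (p(θ) + p(θ+π))/2 + c₁ cos θ + c₂ sin θ (the support function of the Steiner symmetral S_K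 translated so its center is the Steiner point of K). Then L² − 4πA + (π/2)∫₀^{2π}(Q(θ)² − Q'(θ)²) dθ ≥ 8π² · (sup_θ |p(θ) − p_S(θ)|)², i.e. L_{∂K}² − 4πA_{∂K} − π|Ã_{CWMS(∂K)}| ≥ 8π² d_∞²(K, S_K), with equality if and only if p(θ) − p(θ+π) = 2(c₁ cos θ + c₂ sin θ) for all θ, i.e. if and only if ∂K is centrally symmetric. -/
open Real

/-- The function `w² cot` extends continuously by `0` to a zero of `sin` at which `w` vanishes. -/
lemma continuousAt_sq_mul_cos_div_sin {w : ℝ → ℝ} {d a : ℝ} (hd : HasDerivAt w d a)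
    (hw : w a = 0) (hs : sin a = 0) :
    ContinuousAt (fun x => w x ^ 2 * cos x / sin x) a := by
  have hc : cos a ≠ 0 := fun h => by
    have := sin_sq_add_cos_sq a
    simp [hs, h] at this
  rw [continuousAt_iff_punctured_nhds]
  have h1 := hasDerivAt_iff_tendsto_slope.1 hd
  have h2 := hasDerivAt_iff_tendsto_slope.1 (hasDerivAt_sin a)
  have h3 : Filter.Tendsto (fun x => w x * cos x) (nhdsWithin a {a}ᶜ) (nhds (w a * cos a)) :=
    (hd.continuousAt.mul continuous_cos.continuousAt).tendsto.mono_left nhdsWithin_le_nhds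
  have h4 := h3.mul (h1.div h2 hc)
  simp only [hw, hs, zero_mul, div_zero] at h4 ⊢
  refine h4.congr' ?_
  filter_upwards [self_mem_nhdsWithin] with x hx
  have hx' : x - a ≠ 0 := sub_ne_zero.2 hx
  simp only [slope_def_field, hw, hs, sub_zero, Pi.div_apply]
  rw [div_div_div_cancel_right₀ hx']
  ring

/-- Wirtinger's inequality on `[0, π]` with Dirichlet boundary conditions; an extremal is a
multiple of `sin`, so its derivatives at the two endpoints are opposite. -/
lemma wirtinger_dirichlet {w w' : ℝ → ℝ} (hd : ∀ x, HasDerivAt w (w' x) x)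
    (hc : Continuous w') (h0 : w 0 = 0) (hπ : w π = 0) :
    0 ≤ (∫ x in (0:ℝ)..π, (w' x ^ 2 - w x ^ 2)) ∧
      ((∫ x in (0:ℝ)..π, (w' x ^ 2 - w x ^ 2)) = 0 → w' π = -w' 0) := by
  have hwc : Continuous w := continuous_iff_continuousAt.2 fun x => (hd x).continuousAt
  have hgc : Continuous fun x => w' x ^ 2 - w x ^ 2 := by fun_prop
  set F : ℝ → ℝ := fun x =>
    (∫ t in (0:ℝ)..x, (w' t ^ 2 - w t ^ 2)) - w x ^ 2 * cos x / sin x with hF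
  have hsin : ∀ x ∈ Set.Ioo 0 π, sin x ≠ 0 := fun x hx => (sin_pos_of_mem_Ioo hx).ne'
  have hint : ∀ x, HasDerivAt (fun x => ∫ t in (0:ℝ)..x, (w' t ^ 2 - w t ^ 2))
      (w' x ^ 2 - w x ^ 2) x := fun x => hgc.integral_hasStrictDerivAt 0 x |>.hasDerivAt
  have hFd : ∀ x ∈ Set.Ioo 0 π, HasDerivAt F ((w' x - w x * cos x / sin x) ^ 2) x := by
    intro x hx
    have hs := hsin x hx
    have h := (hint x).sub
      ((((hd x).pow 2).mul (hasDerivAt_cos x)).div (hasDerivAt_sin x) hs)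
    refine h.congr_deriv ?_
    simp only [Pi.mul_apply, Pi.pow_apply]
    field_simp
    ring
  have hFc : ContinuousOn F (Set.Icc 0 π) := by
    intro x hx
    refine ContinuousAt.continuousWithinAt ((hint x).continuousAt.sub ?_)
    rcases hx.1.eq_or_lt with h | h
    · subst h; exact continuousAt_sq_mul_cos_div_sin (hd 0) h0 sin_zero
    rcases hx.2.eq_or_lt with h' | h'
    · subst h'; exact continuousAt_sq_mul_cos_div_sin (hd π) hπ sin_pi
    · exact ((hwc.continuousAt.pow 2).mul continuous_cos.continuousAt).div
        continuous_sin.continuousAt (hsin x ⟨h, h'⟩)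
  have hmono : MonotoneOn F (Set.Icc 0 π) := by
    refine monotoneOn_of_deriv_nonneg (convex_Icc 0 π) hFc ?_ ?_ <;> rw [interior_Icc]
    · exact fun x hx => (hFd x hx).differentiableAt.differentiableWithinAt
    · exact fun x hx => (hFd x hx).deriv ▸ sq_nonneg _
  have hF0 : F 0 = 0 := by simp [hF]
  have hFπ : F π = ∫ x in (0:ℝ)..π, (w' x ^ 2 - w x ^ 2) := by simp [hF]
  have hl : (0:ℝ) ∈ Set.Icc 0 π := ⟨le_rfl, pi_pos.le⟩
  have hr : π ∈ Set.Icc 0 π := ⟨pi_pos.le, le_rfl⟩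
  refine ⟨?_, fun hI => ?_⟩
  · rw [← hFπ, ← hF0]
    exact hmono hl hr pi_pos.le
  have hzero : ∀ x ∈ Set.Ioo 0 π, w' x * sin x = w x * cos x := by
    intro x hx
    have hev : F =ᶠ[nhds x] fun _ => 0 := by
      filter_upwards [Ioo_mem_nhds hx.1 hx.2] with y hy
      have hy' : y ∈ Set.Icc 0 π := Set.Ioo_subset_Icc_self hy
      have h1 := hmono hl hy' hy.1.le
      have h2 := hmono hy' hr hy.2.le
      rw [hF0] at h1
      rw [hFπ, hI] at h2
      exact le_antisymm h2 h1
    have h := (hFd x hx).unique ((hasDerivAt_const x (0:ℝ)).congr_of_eventuallyEq hev)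
    have h' := pow_eq_zero_iff (two_ne_zero) |>.1 h
    have hs := hsin x hx
    field_simp at h'
    linarith
  have hmid : π / 2 ∈ Set.Ioo 0 π := ⟨by positivity, by linarith [pi_pos]⟩
  have hconst : ∀ x ∈ Set.Ioo 0 π, w x / sin x = w (π / 2) / sin (π / 2) := by
    intro x hx
    have hdq : ∀ y ∈ Set.Ioo 0 π, HasDerivAt (fun y => w y / sin y) 0 y := by
      intro y hy
      refine ((hd y).div (hasDerivAt_sin y) (hsin y hy)).congr_deriv ?_
      rw [hzero y hy]; simp
    exact isOpen_Ioo.is_const_of_deriv_eq_zero isPreconnected_Ioo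
      (fun y hy => (hdq y hy).differentiableAt.differentiableWithinAt)
      (fun y hy => (hdq y hy).deriv) hx hmid
  have hder : Set.EqOn w' (fun x => w (π / 2) * cos x) (Set.Ioo 0 π) := by
    intro x hx
    have h1 := hconst x hx
    have hs := hsin x hx
    rw [sin_pi_div_two, div_one, div_eq_iff hs] at h1
    have h2 := hzero x hx
    rw [h1] at h2
    apply mul_right_cancel₀ hs
    simp only
    linear_combination h2
  have hcl := hder.closure hc (continuous_const.mul continuous_cos)
  rw [closure_Ioo pi_pos.ne] at hcl
  have e0 := hcl hl
  have eπ := hcl hr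
  simp only [cos_zero, cos_pi] at e0 eπ
  rw [e0, eπ]; ring

/-- The sharp pointwise bound for an antiperiodic function orthogonal to `cos`. The comparison
function `(2x - π) sin x + cos x` is a multiple of the Green's function at `0`. -/
lemma sq_apply_zero_le_of_antiperiodic {f f' : ℝ → ℝ} (hd : ∀ x, HasDerivAt f (f' x) x)
    (hc : Continuous f') (hanti : ∀ x, f (x + π) = -f x)
    (horth : (∫ x in (0:ℝ)..π, f x * cos x) = 0) :
    2 * π * f 0 ^ 2 ≤ (∫ x in (0:ℝ)..π, (f' x ^ 2 - f x ^ 2)) ∧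
      ((∫ x in (0:ℝ)..π, (f' x ^ 2 - f x ^ 2)) = 2 * π * f 0 ^ 2 → f 0 = 0) := by
  have hfc : Continuous f := continuous_iff_continuousAt.2 fun x => (hd x).continuousAt
  set M := f 0 with hM
  have hfπ : f π = -M := by simpa using hanti 0
  have hanti' : f' π = -f' 0 := by
    have h1 : HasDerivAt (fun x => f (x + π)) (f' (0 + π)) 0 := (hd (0 + π)).comp_add_const 0 π
    have h2 : HasDerivAt (fun x => f (x + π)) (-f' 0) 0 := by
      rw [funext hanti]; exact (hd 0).neg
    simpa using h1.unique h2
  set k : ℝ → ℝ := fun x => (2 * x - π) * sin x + cos x with hk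
  set k' : ℝ → ℝ := fun x => sin x + (2 * x - π) * cos x with hk'
  have hkd : ∀ x, HasDerivAt k (k' x) x := fun x => by
    have h := ((((hasDerivAt_id x).const_mul 2).sub_const π).mul (hasDerivAt_sin x)).add
      (hasDerivAt_cos x)
    refine h.congr_deriv ?_
    simp only [hk', id]; ring
  have hkd' : ∀ x, HasDerivAt k' (4 * cos x - k x) x := fun x => by
    have h := (hasDerivAt_sin x).add
      ((((hasDerivAt_id x).const_mul 2).sub_const π).mul (hasDerivAt_cos x))
    refine h.congr_deriv ?_
    simp only [hk, id]; ring
  have hkc : Continuous k := by fun_prop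
  have hkc' : Continuous k' := by fun_prop
  have hwd : ∀ x, HasDerivAt (fun x => f x - M * k x) (f' x - M * k' x) x :=
    fun x => (hd x).sub ((hkd x).const_mul M)
  have hw := wirtinger_dirichlet hwd (by fun_prop) (by simp [hk, hM]) (by simp [hk, hfπ])
  have hB : (∫ x in (0:ℝ)..π, (2 * M * (f' x * k' x + f x * (4 * cos x - k x))
      - M ^ 2 * (k' x * k' x + k x * (4 * cos x - k x)))) =
      (2 * M * (f π * k' π) - M ^ 2 * (k π * k' π)) -
        (2 * M * (f 0 * k' 0) - M ^ 2 * (k 0 * k' 0)) := by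
    refine intervalIntegral.integral_eq_sub_of_hasDerivAt
      (f := fun x => 2 * M * (f x * k' x) - M ^ 2 * (k x * k' x)) (fun x _ => ?_)
      (Continuous.intervalIntegrable (by fun_prop) _ _)
    exact (((hd x).mul (hkd' x)).const_mul _).sub (((hkd x).mul (hkd' x)).const_mul _)
  have hkorth : (∫ x in (0:ℝ)..π, k x * cos x) = 0 := by
    have h := intervalIntegral.integral_eq_sub_of_hasDerivAt (a := 0) (b := π)
      (f := fun x => (2 * x - π) * sin x ^ 2 / 2 + sin x * cos x)
      (f' := fun x => k x * cos x) (fun x _ => ?_)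
      (Continuous.intervalIntegrable (by fun_prop) _ _)
    · rw [h]; simp
    · have h := (((((hasDerivAt_id x).const_mul 2).sub_const π).mul
        ((hasDerivAt_sin x).pow 2)).div_const 2).add ((hasDerivAt_sin x).mul (hasDerivAt_cos x))
      refine h.congr_deriv ?_
      simp only [hk, id, Pi.pow_apply]
      push_cast
      ring
  have hsplit : (∫ x in (0:ℝ)..π, (f' x ^ 2 - f x ^ 2)) =
      (∫ x in (0:ℝ)..π, ((f' x - M * k' x) ^ 2 - (f x - M * k x) ^ 2)) + 2 * π * M ^ 2 := by
    have h1 : ∀ x, f' x ^ 2 - f x ^ 2 = ((f' x - M * k' x) ^ 2 - (f x - M * k x) ^ 2) +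
        (2 * M * (f' x * k' x + f x * (4 * cos x - k x))
          - M ^ 2 * (k' x * k' x + k x * (4 * cos x - k x))) -
        8 * M * (f x * cos x) + 4 * M ^ 2 * (k x * cos x) := fun x => by ring
    simp_rw [h1]
    rw [intervalIntegral.integral_add, intervalIntegral.integral_sub,
      intervalIntegral.integral_add, hB, intervalIntegral.integral_const_mul,
      intervalIntegral.integral_const_mul, horth, hkorth, hfπ]
    · simp [hk, hk', ← hM]; ring
    all_goals exact Continuous.intervalIntegrable (by fun_prop) _ _
  refine ⟨by linarith [hw.1], fun h => ?_⟩
  have h2 := hw.2 (by linarith)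
  simp only [hanti', hk', sin_pi, cos_pi, sin_zero, cos_zero] at h2
  have : M * π = 0 := by linarith
  exact (mul_eq_zero.1 this).resolve_right pi_ne_zero

/-- The integral of a function over `[0, 2π]`, folded onto `[0, π]`. -/
lemma integral_zero_two_pi_eq_fold {g : ℝ → ℝ} (hg : Continuous g) :
    (∫ x in (0:ℝ)..(2 * π), g x) = ∫ x in (0:ℝ)..π, (g x + g (x + π)) := by
  rw [intervalIntegral.integral_add (hg.intervalIntegrable _ _)
    (Continuous.intervalIntegrable (by fun_prop) _ _),
    intervalIntegral.integral_comp_add_right, zero_add, ← two_mul,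
    intervalIntegral.integral_add_adjacent_intervals (hg.intervalIntegrable _ _)
      (hg.intervalIntegrable _ _)]

/-- The sharp pointwise bound at an arbitrary point for an antiperiodic function orthogonal to the
first harmonics. -/
lemma sq_apply_le_of_antiperiodic {f f' : ℝ → ℝ} (hd : ∀ x, HasDerivAt f (f' x) x)
    (hc : Continuous f') (hanti : ∀ x, f (x + π) = -f x)
    (hcos : (∫ x in (0:ℝ)..π, f x * cos x) = 0)
    (hsin : (∫ x in (0:ℝ)..π, f x * sin x) = 0) (a : ℝ) :
    2 * π * f a ^ 2 ≤ (∫ x in (0:ℝ)..π, (f' x ^ 2 - f x ^ 2)) ∧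
      ((∫ x in (0:ℝ)..π, (f' x ^ 2 - f x ^ 2)) = 2 * π * f a ^ 2 → f a = 0) := by
  have hfc : Continuous f := continuous_iff_continuousAt.2 fun x => (hd x).continuousAt
  have hanti' : ∀ x, f' (x + π) = -f' x := fun x => by
    have h1 : HasDerivAt (fun x => f (x + π)) (f' (x + π)) x := (hd (x + π)).comp_add_const x π
    have h2 : HasDerivAt (fun x => f (x + π)) (-f' x) x := by
      rw [funext hanti]; exact (hd x).neg
    exact h1.unique h2
  have hshift : ∀ g : ℝ → ℝ, Function.Periodic g π →
      (∫ x in (0:ℝ)..π, g (x + a)) = ∫ x in (0:ℝ)..π, g x := fun g hg => by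
    rw [intervalIntegral.integral_comp_add_right, zero_add, add_comm π a]
    simpa using hg.intervalIntegral_add_eq a 0
  have horth : (∫ x in (0:ℝ)..π, f (x + a) * cos x) = 0 := by
    have h := hshift (fun x => f x * cos (x - a)) (fun x => by
      simp only [hanti, show x + π - a = x - a + π by ring, cos_add_pi]; ring)
    simp only [add_sub_cancel_right] at h
    rw [h]
    have h1 : ∀ x, f x * cos (x - a) = cos a * (f x * cos x) + sin a * (f x * sin x) := fun x => by
      rw [cos_sub]; ring
    simp_rw [h1]
    rw [intervalIntegral.integral_add, intervalIntegral.integral_const_mul,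
      intervalIntegral.integral_const_mul, hcos, hsin]
    · simp
    all_goals exact Continuous.intervalIntegrable (by fun_prop) _ _
  have key := sq_apply_zero_le_of_antiperiodic (f := fun x => f (x + a))
    (f' := fun x => f' (x + a)) (fun x => (hd (x + a)).comp_add_const x a) (by fun_prop)
    (fun x => by rw [← hanti]; ring_nf) horth
  rw [hshift (fun x => f' x ^ 2 - f x ^ 2) (fun x => by simp only [hanti, hanti']; ring)] at key
  simpa using key

/-- Fourier coefficient identities for the first harmonics over a half period. -/
lemma integral_half_period_first_harmonics (a b : ℝ) :
    (∫ x in (0:ℝ)..π, (a * cos x + b * sin x) * cos x) = a * (π / 2) ∧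
    (∫ x in (0:ℝ)..π, (a * cos x + b * sin x) * sin x) = b * (π / 2) := by
  have h1 : ∀ x, (a * cos x + b * sin x) * cos x = a * cos x ^ 2 + b * (sin x * cos x) :=
    fun x => by ring
  have h2 : ∀ x, (a * cos x + b * sin x) * sin x = a * (sin x * cos x) + b * sin x ^ 2 :=
    fun x => by ring
  simp_rw [h1, h2]
  constructor <;>
  · rw [intervalIntegral.integral_add, intervalIntegral.integral_const_mul,
      intervalIntegral.integral_const_mul]
    · simp [integral_cos_sq, integral_sin_sq, integral_sin_mul_cos₁]
    all_goals exact Continuous.intervalIntegrable (by fun_prop) _ _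

/-- The isoperimetric deficit corrected by the constant width measure set equals the Dirichlet
form of the antisymmetric part of the support function, which ignores first harmonics. -/
lemma improved_deficit_eq {p p' : ℝ → ℝ} (hd : ∀ x, HasDerivAt p (p' x) x) (hc : Continuous p')
    (hper : ∀ x, p (x + 2 * π) = p x) (hper' : ∀ x, p' (x + 2 * π) = p' x)
    (L a b : ℝ) (hL : L = ∫ x in (0:ℝ)..(2 * π), p x) :
    L ^ 2 - 4 * π * ((1 / 2) * ∫ x in (0:ℝ)..(2 * π), (p x ^ 2 - p' x ^ 2)) +
      (π / 2) * (∫ x in (0:ℝ)..(2 * π),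
        ((p x + p (x + π) - L / π) ^ 2 - (p' x + p' (x + π)) ^ 2)) =
    4 * π * ∫ x in (0:ℝ)..π,
      (((p' x - p' (x + π)) / 2 - (b * cos x - a * sin x)) ^ 2 -
        ((p x - p (x + π)) / 2 - (a * cos x + b * sin x)) ^ 2) := by
  have hpc : Continuous p := continuous_iff_continuousAt.2 fun x => (hd x).continuousAt
  have hdπ : ∀ x, HasDerivAt (fun x => p (x + π)) (p' (x + π)) x :=
    fun x => (hd (x + π)).comp_add_const x π
  have hdc : ∀ x, HasDerivAt (fun x => b * cos x - a * sin x) (-(a * cos x + b * sin x)) x :=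
    fun x => (((hasDerivAt_cos x).const_mul b).sub ((hasDerivAt_sin x).const_mul a)).congr_deriv
      (by ring)
  have hds : ∀ x, HasDerivAt (fun x => a * cos x + b * sin x) (b * cos x - a * sin x) x :=
    fun x => (((hasDerivAt_cos x).const_mul a).add ((hasDerivAt_sin x).const_mul b)).congr_deriv
      (by ring)
  have h2 : ∀ x, x + π + π = x + 2 * π := fun x => by ring
  have hL' : L = ∫ x in (0:ℝ)..π, (p x + p (x + π)) := by
    rw [hL, integral_zero_two_pi_eq_fold hpc]
  have hB : (∫ x in (0:ℝ)..π, ((p' x - p' (x + π) - (b * cos x - a * sin x)) *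
      (b * cos x - a * sin x) + (p x - p (x + π) - (a * cos x + b * sin x)) *
      -(a * cos x + b * sin x))) = 0 := by
    refine (intervalIntegral.integral_eq_sub_of_hasDerivAt
      (f := fun x => (p x - p (x + π) - (a * cos x + b * sin x)) * (b * cos x - a * sin x))
      (fun x _ => (((hd x).sub (hdπ x)).sub (hds x)).mul (hdc x))
      (Continuous.intervalIntegrable (by fun_prop) _ _)).trans ?_
    have h := hper 0
    simp only [zero_add] at h
    simp [← two_mul, h]; ring
  rw [integral_zero_two_pi_eq_fold (by fun_prop), integral_zero_two_pi_eq_fold (by fun_prop)]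
  simp only [h2, hper, hper']
  have hpw : ∀ x, (p x + p (x + π) - L / π) ^ 2 - (p' x + p' (x + π)) ^ 2 +
      ((p (x + π) + p x - L / π) ^ 2 - (p' (x + π) + p' x) ^ 2) =
      2 * (p x ^ 2 - p' x ^ 2 + (p (x + π) ^ 2 - p' (x + π) ^ 2)) * 2 +
      8 * (((p' x - p' (x + π)) / 2 - (b * cos x - a * sin x)) ^ 2 -
        ((p x - p (x + π)) / 2 - (a * cos x + b * sin x)) ^ 2) +
      8 * ((p' x - p' (x + π) - (b * cos x - a * sin x)) *
      (b * cos x - a * sin x) + (p x - p (x + π) - (a * cos x + b * sin x)) *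
      -(a * cos x + b * sin x)) - 4 * (L / π) * (p x + p (x + π)) + 2 * (L / π) ^ 2 :=
    fun x => by ring
  generalize hI : (∫ x in (0:ℝ)..π, ((p x + p (x + π) - L / π) ^ 2 - (p' x + p' (x + π)) ^ 2 +
    ((p (x + π) + p x - L / π) ^ 2 - (p' (x + π) + p' x) ^ 2))) = I
  simp_rw [hpw] at hI
  rw [intervalIntegral.integral_add, intervalIntegral.integral_sub, intervalIntegral.integral_add,
    intervalIntegral.integral_add, intervalIntegral.integral_mul_const,
    intervalIntegral.integral_const_mul, intervalIntegral.integral_const_mul,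
    intervalIntegral.integral_const_mul, intervalIntegral.integral_const_mul, hB, ← hL',
    intervalIntegral.integral_const] at hI
  · rw [smul_eq_mul] at hI
    have hLπ : L / π * π = L := div_mul_cancel₀ L pi_ne_zero
    linear_combination -(π / 2) * hI + (L / π * π - L) * hLπ
  all_goals exact Continuous.intervalIntegrable (by fun_prop) _ _

theorem stmt_18 (p Q pS : ℝ → ℝ) (hp : ContDiff ℝ (⊤ : ℕ∞) p)
    (hper : ∀ θ : ℝ, p (θ + 2 * π) = p θ)
    (hpos : ∀ θ : ℝ, p θ + deriv (deriv p) θ > 0)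
    (L A c₁ c₂ : ℝ) (hL : L = ∫ θ in (0:ℝ)..(2 * π), p θ)
    (hA : A = (1 / 2) * ∫ θ in (0:ℝ)..(2 * π), (p θ ^ 2 - deriv p θ ^ 2))
    (hQ : ∀ θ : ℝ, Q θ = p θ + p (θ + π) - L / π)
    (hc₁ : c₁ = (1 / π) * ∫ θ in (0:ℝ)..(2 * π), p θ * Real.cos θ)
    (hc₂ : c₂ = (1 / π) * ∫ θ in (0:ℝ)..(2 * π), p θ * Real.sin θ)
    (hpS : ∀ θ : ℝ, pS θ = (p θ + p (θ + π)) / 2 + c₁ * Real.cos θ + c₂ * Real.sin θ) :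
    L ^ 2 - 4 * π * A + (π / 2) * (∫ θ in (0:ℝ)..(2 * π), (Q θ ^ 2 - deriv Q θ ^ 2))
      ≥ 8 * π ^ 2 * (⨆ θ : ℝ, |p θ - pS θ|) ^ 2 ∧
    (L ^ 2 - 4 * π * A + (π / 2) * (∫ θ in (0:ℝ)..(2 * π), (Q θ ^ 2 - deriv Q θ ^ 2))
        = 8 * π ^ 2 * (⨆ θ : ℝ, |p θ - pS θ|) ^ 2 ↔
      ∀ θ : ℝ, p θ - p (θ + π) = 2 * (c₁ * Real.cos θ + c₂ * Real.sin θ)) := by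
  have hd : ∀ x, HasDerivAt p (deriv p x) x := fun x =>
    (hp.differentiable (by simp)).differentiableAt.hasDerivAt
  have hc : Continuous (deriv p) := hp.continuous_deriv (by exact_mod_cast le_top)
  have hpc : Continuous p := hp.continuous
  have hper' : ∀ x, deriv p (x + 2 * π) = deriv p x := fun x => by
    rw [← deriv_comp_add_const, funext hper]
  have hdπ : ∀ x, HasDerivAt (fun x => p (x + π)) (deriv p (x + π)) x :=
    fun x => (hd (x + π)).comp_add_const x π
  have hQd : ∀ x, deriv Q x = deriv p x + deriv p (x + π) := fun x => by
    rw [funext hQ]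
    exact (((hd x).add (hdπ x)).sub_const _).deriv
  have h2 : ∀ x, x + π + π = x + 2 * π := fun x => by ring
  set f : ℝ → ℝ := fun x => (p x - p (x + π)) / 2 - (c₁ * cos x + c₂ * sin x) with hf
  set f' : ℝ → ℝ := fun x =>
    (deriv p x - deriv p (x + π)) / 2 - (c₂ * cos x - c₁ * sin x) with hf'
  have hfd : ∀ x, HasDerivAt f (f' x) x := fun x =>
    ((((hd x).sub (hdπ x)).div_const 2).sub (((hasDerivAt_cos x).const_mul c₁).add
      ((hasDerivAt_sin x).const_mul c₂))).congr_deriv (by simp only [hf']; ring)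
  have hfc : Continuous f := by fun_prop
  have hfc' : Continuous f' := by fun_prop
  have hanti : ∀ x, f (x + π) = -f x := fun x => by
    simp only [hf, h2, hper, cos_add_pi, sin_add_pi]; ring
  have hdef : L ^ 2 - 4 * π * A + (π / 2) * (∫ θ in (0:ℝ)..(2 * π), (Q θ ^ 2 - deriv Q θ ^ 2)) =
      4 * π * ∫ x in (0:ℝ)..π, (f' x ^ 2 - f x ^ 2) := by
    rw [hA]
    simp_rw [hQd, hQ]
    exact improved_deficit_eq hd hc hper hper' L c₁ c₂ hL
  have hcoef : ∀ (g : ℝ → ℝ) (c : ℝ), Continuous g → (∀ x, g (x + π) = -g x) →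
      c = (1 / π) * (∫ θ in (0:ℝ)..(2 * π), p θ * g θ) →
      (∫ x in (0:ℝ)..π, (c₁ * cos x + c₂ * sin x) * g x) = c * (π / 2) →
      (∫ x in (0:ℝ)..π, f x * g x) = 0 := by
    intro g c hg hgπ hcg hI
    rw [integral_zero_two_pi_eq_fold (by fun_prop)] at hcg
    have h1 : ∀ x, f x * g x = (1 / 2) * (p x * g x + p (x + π) * g (x + π)) -
        (c₁ * cos x + c₂ * sin x) * g x := fun x => by rw [hgπ]; simp only [hf]; ring
    simp_rw [h1]
    rw [intervalIntegral.integral_sub, intervalIntegral.integral_const_mul, hI, hcg]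
    · field_simp; ring
    all_goals exact Continuous.intervalIntegrable (by fun_prop) _ _
  have hcos := hcoef cos c₁ continuous_cos cos_add_pi hc₁
    (integral_half_period_first_harmonics c₁ c₂).1
  have hsin := hcoef sin c₂ continuous_sin sin_add_pi hc₂
    (integral_half_period_first_harmonics c₁ c₂).2
  have hsub : ∀ x, p x - pS x = f x := fun x => by rw [hpS]; simp only [hf]; ring
  have hcompact : IsCompact (Set.range fun x => |f x|) :=
    Function.Periodic.compact_of_continuous (c := π) (fun x => by simp [hanti]) pi_ne_zero
      hfc.abs
  obtain ⟨a, ha⟩ : (⨆ θ, |f θ|) ∈ Set.range fun x => |f x| :=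
    hcompact.sSup_mem (Set.range_nonempty _)
  have hle : ∀ x, |f x| ≤ |f a| := fun x => by
    have h := le_ciSup hcompact.bddAbove x
    simp only at ha
    rwa [ha]
  obtain ⟨hineq, heq⟩ := sq_apply_le_of_antiperiodic hfd hfc' hanti hcos hsin a
  simp only at ha
  simp_rw [hsub]
  rw [hdef, ← ha, sq_abs]
  refine ⟨by nlinarith [pi_pos], fun h => ?_, fun h => ?_⟩
  · have h0 := heq (mul_left_cancel₀ (mul_ne_zero four_ne_zero pi_ne_zero)
      (h.trans (by ring)))
    intro θ
    have h1 := hle θ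
    rw [h0, abs_zero] at h1
    have h3 : f θ = 0 := abs_nonpos_iff.1 h1
    simp only [hf] at h3
    linarith
  · have hz : ∀ x, f x = 0 := fun x => by simp only [hf, h]; ring
    have hz' : ∀ x, f' x = 0 := fun x =>
      (hfd x).unique (by rw [funext hz]; exact hasDerivAt_const x 0)
    simp [hz, hz']
end

section
/- (Stability of the improved isoperimetric inequality in the L²-metric.) Let p : ℝ → ℝ be a C^∞ function with p(θ + 2π) = p(θ) for all θ and p(θ) + p''(θ) > 0 for all θ. Set L = ∫₀^{2π} p(θ) dθ, A = (1/2)∫₀^{2π}(p(θ)² − p'(θ)²) dθ, Q(θ) = p(θ) + p(θ+π) − L/π, c₁ = (1/π)∫₀^{2π} p(θ) cos θ dθ, c₂ = (1/π)∫₀^{2π} p(θ) sin θ dθ, and p_S(θ) = (p(θ) + p(θ+π))/2 + c₁ cos θ + c₂ sin θ. Then L² − 4πA + (π/2)∫₀^{2π}(Q(θ)² − Q'(θ)²) dθ ≥ 16π ∫₀^{2π}(p(θ) − p_S(θ))² dθ, i.e. L_{∂K}² − 4πA_{∂K} − π|Ã_{CWMS(∂K)}| ≥ 16π d₂²(K,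 S_K), with equality if and only if there exist a₃, b₃ ∈ ℝ such that p(θ) − p_S(θ) = a₃ cos 3θ + b₃ sin 3θ for all θ (in particular equality holds when ∂K is centrally symmetric). -/
open Real

open MeasureTheory Function

/-- The (unnormalized) `n`-th complex Fourier coefficient of a real function on `[0, 2π]`. -/
noncomputable def expIntegral (f : ℝ → ℝ) (n : ℤ) : ℂ :=
  ∫ x in (0:ℝ)..(2 * π), Complex.exp (-(n * x * Complex.I)) * (f x : ℂ)

theorem integral_deriv_eq_zero_of_periodic {E : Type*} [NormedAddCommGroup E] [NormedSpace ℝ E]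
    [CompleteSpace E] {f f' : ℝ → E} (hf : ∀ x, HasDerivAt f (f' x) x) (hf' : Continuous f')
    (hper : Periodic f (2 * π)) : ∫ x in (0:ℝ)..(2 * π), f' x = 0 := by
  rw [intervalIntegral.integral_eq_sub_of_hasDerivAt (fun x _ => hf x)
    (hf'.intervalIntegrable _ _)]
  simpa using sub_eq_zero.2 (hper 0)

theorem integral_comp_add_pi_of_periodic {E : Type*} [NormedAddCommGroup E] [NormedSpace ℝ E]
    {f : ℝ → E} (hper : Periodic f (2 * π)) :
    ∫ x in (0:ℝ)..(2 * π), f (x + π) = ∫ x in (0:ℝ)..(2 * π), f x := by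
  rw [intervalIntegral.integral_comp_add_right, zero_add, add_comm (2 * π) π]
  simpa using hper.intervalIntegral_add_eq π 0

theorem integral_eq_zero_of_antiperiodic {f : ℝ → ℂ} (h : Antiperiodic f π) :
    ∫ x in (0:ℝ)..(2 * π), f x = 0 := by
  have h1 := integral_comp_add_pi_of_periodic h.periodic_two_mul
  simp only [h _, intervalIntegral.integral_neg] at h1
  exact self_eq_neg.1 h1.symm

theorem exp_neg_mul_I_periodic (n : ℤ) :
    Periodic (fun x : ℝ => Complex.exp (-(n * x * Complex.I))) (2 * π) := by
  intro x
  have : (-((n : ℂ) * ((x + 2 * π : ℝ) : ℂ) * Complex.I))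
      = -(n * x * Complex.I) + ((-n : ℤ) : ℂ) * (2 * π * Complex.I) := by
    push_cast; ring
  simp only [this, Complex.exp_add, Complex.exp_int_mul_two_pi_mul_I, mul_one]

theorem hasSum_sq_norm_expIntegral {f : ℝ → ℝ} (hf : Continuous f) :
    HasSum (fun n => ‖expIntegral f n‖ ^ 2) (2 * π * ∫ x in (0:ℝ)..(2 * π), f x ^ 2) := by
  have hpi : (0:ℝ) < 2 * π := two_pi_pos
  have hcont : Continuous fun x => (f x : ℂ) := Complex.continuous_ofReal.comp hf
  have hL2 : MemLp (fun x => (f x : ℂ)) 2 (volume.restrict (Set.Ioc 0 (2 * π))) := by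
    obtain ⟨C, hC⟩ := (isCompact_Icc (a := (0:ℝ)) (b := 2 * π)).exists_bound_of_continuousOn
      hcont.continuousOn
    exact MemLp.of_bound hcont.aestronglyMeasurable C
      ((ae_restrict_mem measurableSet_Ioc).mono fun x hx => hC x (Set.Ioc_subset_Icc_self hx))
  have h := (hasSum_sq_fourierCoeffOn hpi hL2).mul_left ((2 * π) ^ 2)
  convert! h using 1
  · ext n
    rw [fourierCoeffOn_eq_integral, sub_zero, norm_smul, ← mul_pow, Real.norm_eq_abs,
      abs_of_pos (one_div_pos.2 hpi), ← mul_assoc, mul_one_div_cancel hpi.ne', one_mul,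
      expIntegral]
    congr 2
    refine intervalIntegral.integral_congr fun x _ => ?_
    simp only [fourier_coe_apply, smul_eq_mul]
    congr 2
    have := Complex.ofReal_ne_zero.2 pi_ne_zero
    push_cast
    field_simp
  · simp only [Complex.norm_real, Real.norm_eq_abs, sq_abs, smul_eq_mul, sub_zero]
    field_simp

theorem expIntegral_deriv {f f' : ℝ → ℝ} (hf : ∀ x, HasDerivAt f (f' x) x) (hf' : Continuous f')
    (hper : Periodic f (2 * π)) (n : ℤ) :
    expIntegral f' n = n * Complex.I * expIntegral f n := by
  have hfc : Continuous f := continuous_iff_continuousAt.2 fun x => (hf x).continuousAt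
  have hd : ∀ x : ℝ, HasDerivAt (fun x : ℝ => Complex.exp (-(n * x * Complex.I)) * (f x : ℂ))
      (Complex.exp (-(n * x * Complex.I)) * (f' x : ℂ)
        - n * Complex.I * (Complex.exp (-(n * x * Complex.I)) * (f x : ℂ))) x := by
    intro x
    have h1 : HasDerivAt (fun x : ℝ => -((n : ℂ) * x * Complex.I)) (-(n * 1 * Complex.I)) x :=
      (((hasDerivAt_id x).ofReal_comp.const_mul (n : ℂ)).mul_const Complex.I).neg
    convert! h1.cexp.mul (hf x).ofReal_comp using 1
    ring
  have h := integral_deriv_eq_zero_of_periodic hd (by fun_prop) (by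
    intro x
    have := exp_neg_mul_I_periodic n x
    simp only at this ⊢
    rw [this, hper x])
  rw [intervalIntegral.integral_sub (Continuous.intervalIntegrable (by fun_prop) _ _)
    (Continuous.intervalIntegrable (by fun_prop) _ _), intervalIntegral.integral_const_mul,
    sub_eq_zero] at h
  exact h

theorem expIntegral_eq_zero_of_even {f : ℝ → ℝ} (h : Antiperiodic f π) {n : ℤ} (hn : Even n) :
    expIntegral f n = 0 := by
  obtain ⟨k, rfl⟩ := hn
  refine integral_eq_zero_of_antiperiodic fun x => ?_
  have : (-(((k + k : ℤ) : ℂ) * ((x + π : ℝ) : ℂ) * Complex.I))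
      = -(((k + k : ℤ) : ℂ) * x * Complex.I) + ((-k : ℤ) : ℂ) * (2 * π * Complex.I) := by
    push_cast; ring
  simp only [this, Complex.exp_add, Complex.exp_int_mul_two_pi_mul_I, mul_one, h x]
  push_cast; ring

theorem expIntegral_eq_cos_sub_sin {f : ℝ → ℝ} (hf : Continuous f) (n : ℤ) :
    expIntegral f n = ((∫ x in (0:ℝ)..(2 * π), f x * cos (n * x) : ℝ) : ℂ)
      - ((∫ x in (0:ℝ)..(2 * π), f x * sin (n * x) : ℝ) : ℂ) * Complex.I := by
  rw [expIntegral, ← intervalIntegral.integral_ofReal, ← intervalIntegral.integral_ofReal,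
    ← intervalIntegral.integral_mul_const, ← intervalIntegral.integral_sub
      (Continuous.intervalIntegrable (by fun_prop) _ _)
      (Continuous.intervalIntegrable (by fun_prop) _ _)]
  refine intervalIntegral.integral_congr fun x _ => ?_
  have : -((n : ℂ) * x * Complex.I) = ((-(n * x) : ℝ) : ℂ) * Complex.I := by push_cast; ring
  simp only [this, Complex.exp_mul_I, ← Complex.ofReal_cos, ← Complex.ofReal_sin, cos_neg,
    sin_neg]
  push_cast; ring

theorem expIntegral_eq_zero_of_sq_lt_nine {f : ℝ → ℝ} (hf : Continuous f) (h : Antiperiodic f π)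
    (hcos : ∫ x in (0:ℝ)..(2 * π), f x * cos x = 0)
    (hsin : ∫ x in (0:ℝ)..(2 * π), f x * sin x = 0) {n : ℤ} (hn : n ^ 2 < 9) :
    expIntegral f n = 0 := by
  have h1 : n < 3 := by nlinarith
  have h2 : -3 < n := by nlinarith
  interval_cases n
  · exact expIntegral_eq_zero_of_even h (by decide)
  · rw [expIntegral_eq_cos_sub_sin hf]
    simp [hcos, hsin]
  · exact expIntegral_eq_zero_of_even h (by decide)
  · rw [expIntegral_eq_cos_sub_sin hf]
    simp [hcos, hsin]
  · exact expIntegral_eq_zero_of_even h (by decide)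

theorem hasSum_wirtinger_defect {f f' : ℝ → ℝ} (hf : ∀ x, HasDerivAt f (f' x) x)
    (hf' : Continuous f') (hper : Periodic f (2 * π)) :
    HasSum (fun n : ℤ => ((n : ℝ) ^ 2 - 9) * ‖expIntegral f n‖ ^ 2)
      (2 * π * ((∫ x in (0:ℝ)..(2 * π), f' x ^ 2) - 9 * ∫ x in (0:ℝ)..(2 * π), f x ^ 2)) := by
  have hfc : Continuous f := continuous_iff_continuousAt.2 fun x => (hf x).continuousAt
  convert! (hasSum_sq_norm_expIntegral hf').sub ((hasSum_sq_norm_expIntegral hfc).mul_left 9)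
    using 1
  · ext n
    rw [expIntegral_deriv hf hf' hper, norm_mul, norm_mul, Complex.norm_I, Complex.norm_intCast,
      mul_pow, mul_pow, sq_abs]
    ring
  · ring

theorem eq_cos_add_sin_of_expIntegral_eq_zero {f : ℝ → ℝ} (hf : Continuous f)
    (hper : Periodic f (2 * π)) (h : ∀ n : ℤ, n ^ 2 ≠ 9 → expIntegral f n = 0) :
    ∃ a b : ℝ, ∀ x, f x = a * cos (3 * x) + b * sin (3 * x) := by
  have : Fact (0 < 2 * π) := ⟨two_pi_pos⟩
  have hperC : Periodic (fun x => (f x : ℂ)) (2 * π) := fun x => by simp only [hper x]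
  have hfC : Continuous fun x => (f x : ℂ) := by fun_prop
  let F : C(AddCircle (2 * π), ℂ) := ⟨hperC.lift, hfC.quotient_lift _⟩
  have hF : ∀ x : ℝ, F x = f x := fun x => hperC.lift_coe x
  have hexp : ∀ (n : ℤ) (x : ℝ), fourier n (x : AddCircle (2 * π))
      = Complex.exp (n * x * Complex.I) := by
    intro n x
    rw [fourier_coe_apply]
    congr 1
    have := Complex.ofReal_ne_zero.2 pi_ne_zero
    push_cast
    field_simp
  have hcoeff : ∀ n, fourierCoeff F n = (1 / (2 * π)) • expIntegral f n := by
    intro n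
    rw [fourierCoeff_eq_intervalIntegral _ _ 0, zero_add, expIntegral]
    congr 1
    refine intervalIntegral.integral_congr fun x _ => ?_
    simp only [hexp, hF, smul_eq_mul]
    push_cast
    ring_nf
  have hzero : ∀ n ∉ ({3, -3} : Finset ℤ), fourierCoeff F n = 0 := by
    intro n hn
    rw [hcoeff, h n, smul_zero]
    intro h9
    have : (n - 3) * (n + 3) = 0 := by linarith
    simp only [Finset.mem_insert, Finset.mem_singleton, not_or] at hn
    rcases mul_eq_zero.1 this with h | h <;> omega
  set c := fourierCoeff F 3
  set d := fourierCoeff F (-3)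
  refine ⟨c.re + d.re, d.im - c.im, fun x => ?_⟩
  have hs := has_pointwise_sum_fourier_series_of_summable
    (summable_of_ne_finset_zero hzero) (x : AddCircle (2 * π))
  have hs' := hs.unique (hasSum_sum_of_ne_finset_zero (s := {3, -3}) fun n hn => by
    rw [hzero n hn, zero_smul])
  rw [Finset.sum_pair (by decide), hF, hexp, hexp] at hs'
  have e1 : (((3 : ℤ) : ℂ) * x * Complex.I) = ((3 * x : ℝ) : ℂ) * Complex.I := by push_cast; ring
  have e2 : (((-3 : ℤ) : ℂ) * x * Complex.I) = ((-(3 * x) : ℝ) : ℂ) * Complex.I := by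
    push_cast; ring
  rw [e1, e2, Complex.exp_mul_I, Complex.exp_mul_I, ← Complex.ofReal_cos, ← Complex.ofReal_sin,
    ← Complex.ofReal_cos, ← Complex.ofReal_sin, cos_neg, sin_neg] at hs'
  have := congrArg Complex.re hs'
  simp only [Complex.ofReal_re, smul_eq_mul, Complex.add_re, Complex.mul_re, Complex.add_im,
    Complex.mul_im, Complex.ofReal_im, Complex.I_re, Complex.I_im] at this
  rw [this]
  ring

theorem wirtinger_nine {f f' : ℝ → ℝ} (hf : ∀ x, HasDerivAt f (f' x) x) (hf' : Continuous f')
    (hanti : Antiperiodic f π)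
    (hcos : ∫ x in (0:ℝ)..(2 * π), f x * cos x = 0)
    (hsin : ∫ x in (0:ℝ)..(2 * π), f x * sin x = 0) :
    9 * (∫ x in (0:ℝ)..(2 * π), f x ^ 2) ≤ (∫ x in (0:ℝ)..(2 * π), f' x ^ 2) ∧
    ((∫ x in (0:ℝ)..(2 * π), f' x ^ 2) = 9 * (∫ x in (0:ℝ)..(2 * π), f x ^ 2) ↔
      ∃ a b : ℝ, ∀ x, f x = a * cos (3 * x) + b * sin (3 * x)) := by
  have hfc : Continuous f := continuous_iff_continuousAt.2 fun x => (hf x).continuousAt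
  have hper : Periodic f (2 * π) := hanti.periodic_two_mul
  have hsum := hasSum_wirtinger_defect hf hf' hper
  have hnonneg : ∀ n : ℤ, 0 ≤ ((n : ℝ) ^ 2 - 9) * ‖expIntegral f n‖ ^ 2 := by
    intro n
    rcases lt_or_ge (n ^ 2) 9 with hn | hn
    · simp [expIntegral_eq_zero_of_sq_lt_nine hfc hanti hcos hsin hn]
    · have : (9 : ℝ) ≤ (n : ℝ) ^ 2 := by exact_mod_cast hn
      exact mul_nonneg (by linarith) (sq_nonneg _)
  refine ⟨?_, fun heq => ?_, ?_⟩
  · have h0 := hsum.nonneg hnonneg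
    exact sub_nonneg.1 ((mul_nonneg_iff_of_pos_left two_pi_pos).1 h0)
  · rw [heq, sub_self, mul_zero, hasSum_zero_iff_of_nonneg hnonneg] at hsum
    refine eq_cos_add_sin_of_expIntegral_eq_zero hfc hper fun n hn => ?_
    have hn' : (n : ℝ) ^ 2 - 9 ≠ 0 := sub_ne_zero.2 (by exact_mod_cast hn)
    simpa [hn'] using congrFun hsum n
  · rintro ⟨a, b, hab⟩
    have hcosd : ∀ x : ℝ, HasDerivAt (fun x => cos (3 * x)) (-sin (3 * x) * (3 * 1)) x :=
      fun x => ((hasDerivAt_id x).const_mul 3).cos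
    have hsind : ∀ x : ℝ, HasDerivAt (fun x => sin (3 * x)) (cos (3 * x) * (3 * 1)) x :=
      fun x => ((hasDerivAt_id x).const_mul 3).sin
    have hf'eq : f' = fun x => 3 * (b * cos (3 * x) - a * sin (3 * x)) := by
      ext x
      refine (hf x).unique ?_
      rw [funext hab]
      convert! ((hcosd x).const_mul a).add ((hsind x).const_mul b) using 1
      ring
    have hfd : ∀ x, HasDerivAt f' (-9 * f x) x := by
      intro x
      rw [hf'eq, hab]
      convert! (((hcosd x).const_mul b).sub ((hsind x).const_mul a)).const_mul 3 using 1
      ring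
    have hf'per : Periodic f' (2 * π) := by
      intro x
      have : 3 * (x + 2 * π) = 3 * x + (3 : ℕ) * (2 * π) := by push_cast; ring
      simp only [hf'eq, this, cos_add_nat_mul_two_pi, sin_add_nat_mul_two_pi]
    have h := integral_deriv_eq_zero_of_periodic (fun x => (hf x).mul (hfd x)) (by fun_prop)
      (hper.mul hf'per)
    rw [← sub_eq_zero, ← intervalIntegral.integral_const_mul, ← intervalIntegral.integral_sub
      (Continuous.intervalIntegrable (by fun_prop) _ _)
      (Continuous.intervalIntegrable (by fun_prop) _ _)]
    refine Eq.trans (intervalIntegral.integral_congr fun x _ => ?_) h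
    ring

theorem integral_sub_first_harmonic_mul_cos {p : ℝ → ℝ} (hp : Continuous p)
    (hper : Periodic p (2 * π)) {c₁ c₂ : ℝ}
    (hc₁ : c₁ = (1 / π) * ∫ θ in (0:ℝ)..(2 * π), p θ * cos θ) :
    ∫ θ in (0:ℝ)..(2 * π), ((p θ - p (θ + π)) / 2 - c₁ * cos θ - c₂ * sin θ) * cos θ = 0 := by
  have hshift := integral_comp_add_pi_of_periodic (hper.mul cos_periodic)
  simp only [Pi.mul_apply, cos_add_pi, mul_neg, intervalIntegral.integral_neg] at hshift
  have hsplit : ∀ θ, ((p θ - p (θ + π)) / 2 - c₁ * cos θ - c₂ * sin θ) * cos θ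
      = 1 / 2 * (p θ * cos θ) - 1 / 2 * (p (θ + π) * cos θ) - c₁ * cos θ ^ 2
        - c₂ * (sin θ * cos θ) := fun θ => by ring
  simp only [hsplit]
  rw [intervalIntegral.integral_sub, intervalIntegral.integral_sub, intervalIntegral.integral_sub]
  · simp only [intervalIntegral.integral_const_mul]
    rw [integral_cos_sq, integral_sin_mul_cos₁, neg_eq_iff_eq_neg.1 hshift, hc₁]
    simp only [sin_two_pi, cos_two_pi, sin_zero, cos_zero]
    field_simp
    ring
  all_goals exact Continuous.intervalIntegrable (by fun_prop) _ _

theorem integral_sub_first_harmonic_mul_sin {p : ℝ → ℝ} (hp : Continuous p)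
    (hper : Periodic p (2 * π)) {c₁ c₂ : ℝ}
    (hc₂ : c₂ = (1 / π) * ∫ θ in (0:ℝ)..(2 * π), p θ * sin θ) :
    ∫ θ in (0:ℝ)..(2 * π), ((p θ - p (θ + π)) / 2 - c₁ * cos θ - c₂ * sin θ) * sin θ = 0 := by
  have hshift := integral_comp_add_pi_of_periodic (hper.mul sin_periodic)
  simp only [Pi.mul_apply, sin_add_pi, mul_neg, intervalIntegral.integral_neg] at hshift
  have hsplit : ∀ θ, ((p θ - p (θ + π)) / 2 - c₁ * cos θ - c₂ * sin θ) * sin θ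
      = 1 / 2 * (p θ * sin θ) - 1 / 2 * (p (θ + π) * sin θ) - c₁ * (sin θ * cos θ)
        - c₂ * sin θ ^ 2 := fun θ => by ring
  simp only [hsplit]
  rw [intervalIntegral.integral_sub, intervalIntegral.integral_sub, intervalIntegral.integral_sub]
  · simp only [intervalIntegral.integral_const_mul]
    rw [integral_sin_sq, integral_sin_mul_cos₁, neg_eq_iff_eq_neg.1 hshift, hc₂]
    simp only [sin_two_pi, cos_two_pi, sin_zero, cos_zero]
    field_simp
    ring
  all_goals exact Continuous.intervalIntegrable (by fun_prop) _ _

theorem isoperimetric_deficit_eq {p p' : ℝ → ℝ} (hp : ∀ θ, HasDerivAt p (p' θ) θ)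
    (hp' : Continuous p') (hper : Periodic p (2 * π))
    {L : ℝ} (hL : L = ∫ θ in (0:ℝ)..(2 * π), p θ) (c₁ c₂ : ℝ) :
    L ^ 2 - 2 * π * (∫ θ in (0:ℝ)..(2 * π), (p θ ^ 2 - p' θ ^ 2))
      + π / 2 * (∫ θ in (0:ℝ)..(2 * π),
          ((p θ + p (θ + π) - L / π) ^ 2 - (p' θ + p' (θ + π)) ^ 2))
    = 2 * π * ((∫ θ in (0:ℝ)..(2 * π),
          ((p' θ - p' (θ + π)) / 2 + c₁ * sin θ - c₂ * cos θ) ^ 2)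
        - ∫ θ in (0:ℝ)..(2 * π), ((p θ - p (θ + π)) / 2 - c₁ * cos θ - c₂ * sin θ) ^ 2) := by
  have hpc : Continuous p := continuous_iff_continuousAt.2 fun x => (hp x).continuousAt
  have hq : ∀ θ, HasDerivAt (fun θ => p (θ + π)) (p' (θ + π)) θ :=
    fun θ => (hp (θ + π)).comp_add_const θ π
  have hper' : Periodic p' (2 * π) := fun θ => by
    have h := (hp (θ + 2 * π)).comp_add_const θ (2 * π)
    rw [hper.funext] at h
    exact h.unique (hp θ)
  have hqper : Periodic (fun θ => p (θ + π)) (2 * π) := fun θ => by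
    simp only [add_right_comm θ (2 * π) π, hper (θ + π)]
  have hs : ∀ θ, HasDerivAt (fun θ => c₁ * sin θ - c₂ * cos θ) (c₁ * cos θ + c₂ * sin θ) θ := by
    intro θ
    convert! ((hasDerivAt_sin θ).const_mul c₁).sub ((hasDerivAt_cos θ).const_mul c₂) using 1
    ring
  have hu : ∀ θ, HasDerivAt (fun θ => c₁ * cos θ + c₂ * sin θ) (c₂ * cos θ - c₁ * sin θ) θ := by
    intro θ
    convert! ((hasDerivAt_cos θ).const_mul c₁).add ((hasDerivAt_sin θ).const_mul c₂) using 1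
    ring
  have hcross := integral_deriv_eq_zero_of_periodic
    (f := fun θ => (c₁ * sin θ - c₂ * cos θ)
      * ((p θ - p (θ + π)) - (c₁ * cos θ + c₂ * sin θ)))
    (fun θ => (hs θ).mul (((hp θ).sub (hq θ)).sub (hu θ))) (by fun_prop) (fun θ => by
      simp only [sin_add_two_pi, cos_add_two_pi, hper θ, hqper θ])
  have hshift := integral_comp_add_pi_of_periodic (f := fun θ => p θ ^ 2 - p' θ ^ 2)
    (fun θ => by simp only [hper θ, hper' θ])
  have hLshift := integral_comp_add_pi_of_periodic hper
  have hw : ∀ g : ℝ → ℝ, Continuous g → IntervalIntegrable g volume 0 (2 * π) :=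
    fun g hg => hg.intervalIntegrable _ _
  have hQ : (∫ θ in (0:ℝ)..(2 * π),
        ((p θ + p (θ + π) - L / π) ^ 2 - (p' θ + p' (θ + π)) ^ 2))
      = 2 * (∫ θ in (0:ℝ)..(2 * π), (p θ ^ 2 - p' θ ^ 2))
        + 2 * (∫ θ in (0:ℝ)..(2 * π), (p (θ + π) ^ 2 - p' (θ + π) ^ 2))
        + 4 * (∫ θ in (0:ℝ)..(2 * π), ((p' θ - p' (θ + π)) / 2 + c₁ * sin θ - c₂ * cos θ) ^ 2)
        - 4 * (∫ θ in (0:ℝ)..(2 * π), ((p θ - p (θ + π)) / 2 - c₁ * cos θ - c₂ * sin θ) ^ 2)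
        - 4 * (∫ θ in (0:ℝ)..(2 * π), ((c₁ * cos θ + c₂ * sin θ)
            * ((p θ - p (θ + π)) - (c₁ * cos θ + c₂ * sin θ))
          + (c₁ * sin θ - c₂ * cos θ) * (p' θ - p' (θ + π) - (c₂ * cos θ - c₁ * sin θ))))
        - 2 * (L / π) * (∫ θ in (0:ℝ)..(2 * π), p θ)
        - 2 * (L / π) * (∫ θ in (0:ℝ)..(2 * π), p (θ + π))
        + (∫ θ in (0:ℝ)..(2 * π), (L / π) ^ 2) := by
    simp only [← intervalIntegral.integral_const_mul]
    rw [← intervalIntegral.integral_add, ← intervalIntegral.integral_add,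
      ← intervalIntegral.integral_sub, ← intervalIntegral.integral_sub,
      ← intervalIntegral.integral_sub, ← intervalIntegral.integral_sub,
      ← intervalIntegral.integral_add]
    · refine intervalIntegral.integral_congr fun θ _ => ?_
      ring
    all_goals exact hw _ (by fun_prop)
  have hcross' : (∫ θ in (0:ℝ)..(2 * π), ((c₁ * cos θ + c₂ * sin θ)
            * ((p θ - p (θ + π)) - (c₁ * cos θ + c₂ * sin θ))
          + (c₁ * sin θ - c₂ * cos θ) * (p' θ - p' (θ + π) - (c₂ * cos θ - c₁ * sin θ)))) = 0 :=
    hcross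
  rw [hQ, hcross', hshift, hLshift, ← hL, intervalIntegral.integral_const, smul_eq_mul]
  field_simp
  ring



theorem stmt_19 (p Q pS : ℝ → ℝ) (hp : ContDiff ℝ (⊤ : ℕ∞) p)
    (hper : ∀ θ : ℝ, p (θ + 2 * π) = p θ)
    (hpos : ∀ θ : ℝ, p θ + deriv (deriv p) θ > 0)
    (L A c₁ c₂ : ℝ) (hL : L = ∫ θ in (0:ℝ)..(2 * π), p θ)
    (hA : A = (1 / 2) * ∫ θ in (0:ℝ)..(2 * π), (p θ ^ 2 - deriv p θ ^ 2))
    (hQ : ∀ θ : ℝ, Q θ = p θ + p (θ + π) - L / π)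
    (hc₁ : c₁ = (1 / π) * ∫ θ in (0:ℝ)..(2 * π), p θ * Real.cos θ)
    (hc₂ : c₂ = (1 / π) * ∫ θ in (0:ℝ)..(2 * π), p θ * Real.sin θ)
    (hpS : ∀ θ : ℝ, pS θ = (p θ + p (θ + π)) / 2 + c₁ * Real.cos θ + c₂ * Real.sin θ) :
    L ^ 2 - 4 * π * A + (π / 2) * (∫ θ in (0:ℝ)..(2 * π), (Q θ ^ 2 - deriv Q θ ^ 2))
      ≥ 16 * π * (∫ θ in (0:ℝ)..(2 * π), (p θ - pS θ) ^ 2) ∧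
    (L ^ 2 - 4 * π * A + (π / 2) * (∫ θ in (0:ℝ)..(2 * π), (Q θ ^ 2 - deriv Q θ ^ 2))
        = 16 * π * (∫ θ in (0:ℝ)..(2 * π), (p θ - pS θ) ^ 2) ↔
      ∃ a₃ b₃ : ℝ, ∀ θ : ℝ,
        p θ - pS θ = a₃ * Real.cos (3 * θ) + b₃ * Real.sin (3 * θ)) := by
  have hpd : ∀ θ, HasDerivAt p (deriv p θ) θ :=
    fun θ => (hp.differentiable (by simp)).differentiableAt.hasDerivAt
  have hpc : Continuous p := hp.continuous
  have hp' : Continuous (deriv p) := hp.continuous_deriv (by simp)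
  have hQ' : ∀ θ, deriv Q θ = deriv p θ + deriv p (θ + π) := fun θ => by
    rw [funext hQ]
    exact (((hpd θ).add ((hpd (θ + π)).comp_add_const θ π)).sub_const (L / π)).deriv
  have hw : ∀ θ, p θ - pS θ = (p θ - p (θ + π)) / 2 - c₁ * cos θ - c₂ * sin θ := fun θ => by
    rw [hpS]
    ring
  have hwd : ∀ θ, HasDerivAt (fun θ => (p θ - p (θ + π)) / 2 - c₁ * cos θ - c₂ * sin θ)
      ((deriv p θ - deriv p (θ + π)) / 2 + c₁ * sin θ - c₂ * cos θ) θ := fun θ => by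
    convert! ((((hpd θ).sub ((hpd (θ + π)).comp_add_const θ π)).div_const 2).sub
      ((hasDerivAt_cos θ).const_mul c₁)).sub ((hasDerivAt_sin θ).const_mul c₂) using 1
    ring
  have hanti : Antiperiodic (fun θ => (p θ - p (θ + π)) / 2 - c₁ * cos θ - c₂ * sin θ) π := by
    intro θ
    have : p (θ + π + π) = p θ := by rw [add_assoc, ← two_mul, hper]
    simp only [this, cos_add_pi, sin_add_pi]
    ring
  obtain ⟨hle, hiff⟩ := wirtinger_nine hwd (by fun_prop) hanti
    (integral_sub_first_harmonic_mul_cos hpc hper hc₁)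
    (integral_sub_first_harmonic_mul_sin hpc hper hc₂)
  have hdef : L ^ 2 - 4 * π * A + (π / 2) * (∫ θ in (0:ℝ)..(2 * π), (Q θ ^ 2 - deriv Q θ ^ 2))
      = 2 * π * ((∫ θ in (0:ℝ)..(2 * π),
          ((deriv p θ - deriv p (θ + π)) / 2 + c₁ * sin θ - c₂ * cos θ) ^ 2)
        - ∫ θ in (0:ℝ)..(2 * π), ((p θ - p (θ + π)) / 2 - c₁ * cos θ - c₂ * sin θ) ^ 2) := by
    rw [← isoperimetric_deficit_eq hpd hp' hper hL c₁ c₂, hA]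
    simp only [hQ', hQ]
    ring
  rw [hdef]
  simp only [hw]
  refine ⟨?_, Iff.trans ⟨fun h => ?_, fun h => ?_⟩ hiff⟩
  · nlinarith [mul_le_mul_of_nonneg_left hle two_pi_pos.le]
  · refine mul_left_cancel₀ two_pi_pos.ne' ?_
    linarith
  · rw [h]
    ring
end
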